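/- Fix q' > 0 and e' ∈ (0,1), and let p' = q'(1+e'), Q' = q'(1+e')/(1−e'). For every (q,e) with q > 0 and e ∈ [0,1], the maximum of the nodal distance δ_nod(q,e,ω,ω') over (ω,ω') ∈ D₃ = [0,π/2] × [0,π] equals max{u^e_link(q,e), |p' − q(1+e)|}, where u^e_link(q,e) = min{q(1+e)/(1−e) − q', Q' − q} (so u^e_link(q,1) = Q' − q). -/

import Mathlib

open Real Set Filter Topology

noncomputable section

/-- `a / b` as an extended real, with the convention that it equals `+∞` when `b = 0`. -/
noncomputable def equot (a b : ℝ) : EReal := if b = 0 then ⊤ else ((a / b : ℝ) : EReal)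

noncomputable def rplus (q e ω : ℝ) : EReal := equot (q * (1 + e)) (1 + e * Real.cos ω)

noncomputable def rminus (q e ω : ℝ) : EReal := equot (q * (1 + e)) (1 - e * Real.cos ω)

noncomputable def dplus (q' e' q e ω ω' : ℝ) : EReal :=
  equot (q' * (1 + e')) (1 + e' * Real.cos ω') - rplus q e ω

noncomputable def dminus (q' e' q e ω ω' : ℝ) : EReal :=
  equot (q' * (1 + e')) (1 - e' * Real.cos ω') - rminus q e ω

noncomputable def deltaNod (q' e' q e ω ω' : ℝ) : EReal :=
  min (max (dplus q' e' q e ω ω') (-dplus q' e' q e ω ω'))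
      (max (dminus q' e' q e ω ω') (-dminus q' e' q e ω ω'))

noncomputable def deltaInt (q' e' q e ω ω' : ℝ) : EReal :=
  min (dplus q' e' q e ω ω') (dminus q' e' q e ω ω')

noncomputable def deltaExt (q' e' q e ω ω' : ℝ) : EReal :=
  min (-dplus q' e' q e ω ω') (-dminus q' e' q e ω ω')

noncomputable def deltaLink (q' e' q e ω ω' : ℝ) : EReal :=
  max (min (-dplus q' e' q e ω ω') (dminus q' e' q e ω ω'))
      (min (dplus q' e' q e ω ω') (-dminus q' e' q e ω ω'))


lemma ecoe_max (x y : ℝ) : ((max x y : ℝ) : EReal) = max (x : EReal) (y : EReal) :=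
  EReal.coe_strictMono.monotone.map_max

lemma ecoe_min (x y : ℝ) : ((min x y : ℝ) : EReal) = min (x : EReal) (y : EReal) :=
  EReal.coe_strictMono.monotone.map_min

lemma aux_int (p p' a b : ℝ) (hp : 0 < p) (hp' : 0 < p') (ha : 0 ≤ a) (ha1 : a < 1)
    (hb : 0 ≤ b) (hb1 : b < 1) (P : ℝ) (hP0 : 0 ≤ P) (hP : p' - p ≤ P)
    (h1 : P < p' / (1 + b) - p / (1 + a)) (h2 : P < p' / (1 - b) - p / (1 - a)) : False := by
  have e1 : p' / (1 + b) = p' - p' * b / (1 + b) := by field_simp; ring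
  have e2 : p / (1 + a) = p - p * a / (1 + a) := by field_simp; ring
  have e3 : p' / (1 - b) = p' + p' * b / (1 - b) := by
    have : 1 - b ≠ 0 := by linarith
    field_simp; ring
  have e4 : p / (1 - a) = p + p * a / (1 - a) := by
    have : 1 - a ≠ 0 := by linarith
    field_simp; ring
  have hba : b < a := by
    by_contra hc
    push Not at hc
    have : p' / (1 + b) ≤ p' / (1 + a) := by gcongr
    have h3 : P < (p' - p) / (1 + a) := by rw [sub_div]; linarith
    rw [lt_div_iff₀ (by linarith)] at h3
    nlinarith
  have i1 : p' * b / (1 + b) < p * a / (1 + a) := by linarith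
  have i2 : p * a / (1 - a) < p' * b / (1 - b) := by linarith
  rw [div_lt_div_iff₀ (by linarith) (by linarith)] at i1 i2
  have hb0 : 0 < b := by
    rcases hb.lt_or_eq with h | h
    · exact h
    · subst h
      have : 0 ≤ p * a := by positivity
      nlinarith
  have ha0 : 0 < a := by linarith
  have : 0 < p * a := by positivity
  have : 0 < p' * b := by positivity
  have k1 : (p' * b) < (p * a) := by nlinarith
  nlinarith

lemma aux_real (p p' q q' Q' A e' a b : ℝ) (hp : 0 < p) (hp' : 0 < p') (ha : 0 ≤ a) (ha1 : a < 1)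
    (he' : e' < 1) (hb : -e' ≤ b) (hb1 : b ≤ e') (hq' : q' = p' / (1 + e'))
    (hQ' : Q' = p' / (1 - e')) (hq : q ≤ p / (1 + a)) (hA : p / (1 - a) ≤ A) :
    min |p' / (1 + b) - p / (1 + a)| |p' / (1 - b) - p / (1 - a)| ≤
      max (min (A - q') (Q' - q)) |p' - p| := by
  have r1 : q' ≤ p' / (1 + b) := by rw [hq']; gcongr; linarith
  have r2 : q' ≤ p' / (1 - b) := by rw [hq']; gcongr <;> linarith
  have r3 : p' / (1 + b) ≤ Q' := by rw [hQ']; gcongr <;> linarith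
  have r4 : p' / (1 - b) ≤ Q' := by rw [hQ']; gcongr
  have s1 : p / (1 + a) ≤ p := div_le_self hp.le (by linarith)
  have s2 : p ≤ p / (1 - a) := by rw [le_div_iff₀ (by linarith)]; nlinarith
  by_contra hc
  push Not at hc
  obtain ⟨c1, c2⟩ := max_lt_iff.1 hc
  obtain ⟨c3, c4⟩ := lt_min_iff.1 c2
  have P0 := abs_nonneg (p' - p)
  have P1 := le_abs_self (p' - p)
  have P2 := neg_abs_le (p' - p)
  obtain ⟨c5, c6⟩ := lt_min_iff.1 c1
  have link : ∀ u v : ℝ, min (A - q') (Q' - q) < u → min (A - q') (Q' - q) < v →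
      u ≤ A - q' → v ≤ Q' - q → False := by
    intro u v h1 h2 h3 h4
    rcases min_lt_iff.1 h1 with h | h
    · linarith
    rcases min_lt_iff.1 h2 with h | h
    · have := min_choice (A - q') (Q' - q)
      rcases this with h' | h' <;> linarith
    · linarith
  rcases le_total b 0 with hb0 | hb0
  · have t1 : p' ≤ p' / (1 + b) := by rw [le_div_iff₀ (by linarith)]; nlinarith
    have t2 : p' / (1 - b) ≤ p' := div_le_self hp'.le (by linarith)
    rcases abs_cases (p' / (1 + b) - p / (1 + a)) with ⟨w, _⟩ | ⟨w, _⟩ <;>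
    rcases abs_cases (p' / (1 - b) - p / (1 - a)) with ⟨z, _⟩ | ⟨z, _⟩ <;>
      rw [w] at c3 c5 <;> rw [z] at c4 c6
    · linarith
    · exact link _ _ c6 c5 (by linarith) (by linarith)
    · linarith
    · linarith
  · rcases abs_cases (p' / (1 + b) - p / (1 + a)) with ⟨w, _⟩ | ⟨w, _⟩ <;>
    rcases abs_cases (p' / (1 - b) - p / (1 - a)) with ⟨z, _⟩ | ⟨z, _⟩ <;>
      rw [w] at c3 c5 <;> rw [z] at c4 c6
    · exact aux_int p p' a b hp hp' ha ha1 hb0 (by linarith) _ P0 P1 c3 c4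
    · exact link _ _ c6 c5 (by linarith) (by linarith)
    · exact link _ _ c5 c6 (by linarith) (by linarith)
    · exact aux_int p' p b a hp' hp hb0 (by linarith) ha ha1 _ P0 (by linarith)
        (by linarith) (by linarith)

lemma emax_abs (x : ℝ) : max (x : EReal) (-(x : EReal)) = ((|x| : ℝ) : EReal) := by
  rw [← EReal.coe_neg, ← ecoe_max]; rfl

lemma equot_ne (a b : ℝ) (h : b ≠ 0) : equot a b = ((a / b : ℝ) : EReal) := by
  simp [equot, h]

lemma delta_real (q' e' q e ω ω' : ℝ) (h1 : 1 + e' * cos ω' ≠ 0) (h2 : 1 - e' * cos ω' ≠ 0)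
    (h3 : 1 + e * cos ω ≠ 0) (h4 : 1 - e * cos ω ≠ 0) :
    deltaNod q' e' q e ω ω' =
      ((min |q' * (1 + e') / (1 + e' * cos ω') - q * (1 + e) / (1 + e * cos ω)|
        |q' * (1 + e') / (1 - e' * cos ω') - q * (1 + e) / (1 - e * cos ω)| : ℝ) : EReal) := by
  unfold deltaNod dplus dminus rplus rminus
  rw [equot_ne _ _ h1, equot_ne _ _ h2, equot_ne _ _ h3, equot_ne _ _ h4, ← EReal.coe_sub,
    ← EReal.coe_sub, emax_abs, emax_abs, ← ecoe_min]

lemma delta_top (q' e' q e ω ω' : ℝ) (h1 : 1 + e' * cos ω' ≠ 0) (h2 : 1 - e' * cos ω' ≠ 0)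
    (h3 : 1 + e * cos ω ≠ 0) (h4 : 1 - e * cos ω = 0) :
    deltaNod q' e' q e ω ω' =
      ((|q' * (1 + e') / (1 + e' * cos ω') - q * (1 + e) / (1 + e * cos ω)| : ℝ) : EReal) := by
  unfold deltaNod dplus dminus rplus rminus
  rw [equot_ne _ _ h1, equot_ne _ _ h2, equot_ne _ _ h3, ← EReal.coe_sub, emax_abs]
  simp [equot, h4]

/-- Optimal upper bound for `δ_nod` as a function of `(q, e)`: the maximum over
`(ω, ω') ∈ [0,π/2] × [0,π]` equals `max{u^e_link, |p' - q(1+e)|}`, where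
`u^e_link = min{q(1+e)/(1-e) - q', Q' - q}` (so it equals `Q' - q` when `e = 1`). -/
theorem deltaNod_max_qe (q' e' : ℝ) (hq' : 0 < q') (he' : e' ∈ Ioo (0 : ℝ) 1)
    (p' Q' : ℝ) (hp' : p' = q' * (1 + e')) (hQ' : Q' = q' * (1 + e') / (1 - e'))
    (q e : ℝ) (hq : 0 < q) (he : e ∈ Icc (0 : ℝ) 1) :
    IsGreatest ((fun pr : ℝ × ℝ => deltaNod q' e' q e pr.1 pr.2) '' (Icc 0 (π / 2) ×ˢ Icc 0 π))
      (max (min (equot (q * (1 + e)) (1 - e) - ((q' : ℝ) : EReal)) (((Q' - q : ℝ) : EReal)))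
        ((|p' - q * (1 + e)| : ℝ) : EReal)) := by
  obtain ⟨he'0, he'1⟩ := he'
  obtain ⟨he0, he1⟩ := he
  have hpi := Real.pi_pos
  have hp0 : 0 < q * (1 + e) := by positivity
  have hp'0 : 0 < q' * (1 + e') := by positivity
  have hqq' : q' = q' * (1 + e') / (1 + e') := by field_simp
  have hqq : q = q * (1 + e) / (1 + e) := by field_simp
  have hq'Q : q' * (1 + e') ≤ Q' := by
    rw [hQ', le_div_iff₀ (by linarith)]; nlinarith
  subst hp'
  constructor
  · rcases le_total (min (equot (q * (1 + e)) (1 - e) - ((q' : ℝ) : EReal))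
      (((Q' - q : ℝ) : EReal))) ((|q' * (1 + e') - q * (1 + e)| : ℝ) : EReal) with h | h
    · rw [max_eq_right h]
      refine ⟨(π / 2, π / 2), ⟨⟨by positivity, le_rfl⟩, ⟨by positivity, by linarith⟩⟩, ?_⟩
      simp only
      rw [delta_real] <;> simp
    · rw [max_eq_left h]
      refine ⟨(0, π), ⟨⟨le_rfl, by positivity⟩, ⟨by positivity, le_rfl⟩⟩, ?_⟩
      simp only
      have P0 := abs_nonneg (q' * (1 + e') - q * (1 + e))
      rcases he1.lt_or_eq with h1 | h1
      · rw [delta_real]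
        · rw [equot_ne _ _ (by linarith), ← EReal.coe_sub, ← ecoe_min] at h ⊢
          rw [EReal.coe_le_coe_iff] at h
          obtain ⟨k1, k2⟩ := le_min_iff.1 h
          congr 1
          simp only [Real.cos_pi, Real.cos_zero, mul_one, mul_neg, sub_neg_eq_add, ← sub_eq_add_neg]
          rw [← hQ', ← hqq, ← hqq', abs_sub_comm q', abs_of_nonneg (by linarith),
            abs_of_nonneg (by linarith), min_comm]
        all_goals simp only [Real.cos_pi, Real.cos_zero]; intro hh; linarith
      · subst h1
        rw [delta_top]
        · simp only [equot, sub_self, if_true, EReal.top_sub_coe, min_eq_right le_top] at h ⊢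
          rw [EReal.coe_le_coe_iff] at h
          congr 1
          simp only [Real.cos_pi, Real.cos_zero, mul_one, mul_neg, ← sub_eq_add_neg]
          rw [← hQ', ← hqq, abs_of_nonneg (by linarith)]
        all_goals simp only [Real.cos_pi, Real.cos_zero]
        all_goals first | (intro hh; linarith) | norm_num
  · rintro _ ⟨⟨ω, ω'⟩, ⟨⟨w0, w1⟩, -⟩, rfl⟩
    simp only at w0 w1 ⊢
    have x0 : 0 ≤ cos ω := Real.cos_nonneg_of_mem_Icc ⟨by linarith, w1⟩
    have x1 := Real.cos_le_one ω
    have y0 := Real.neg_one_le_cos ω'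
    have y1 := Real.cos_le_one ω'
    have b0 : -e' ≤ e' * cos ω' := by nlinarith
    have b1 : e' * cos ω' ≤ e' := by nlinarith
    have a0 : 0 ≤ e * cos ω := by positivity
    have a1 : e * cos ω ≤ e := by nlinarith
    have hqle : q ≤ q * (1 + e) / (1 + e * cos ω) := by
      rw [le_div_iff₀ (by linarith)]; nlinarith
    rcases (a1.trans he1).lt_or_eq with ha | ha
    · rw [delta_real _ _ _ _ _ _ (by linarith) (by linarith) (by linarith) (by linarith)]
      have key := fun A hA => aux_real (q * (1 + e)) (q' * (1 + e')) q q' Q' A e' (e * cos ω)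
        (e' * cos ω') hp0 hp'0 a0 ha he'1 b0 b1 hqq' hQ' hqle hA
      rcases he1.lt_or_eq with h1 | h1
      · rw [equot_ne _ _ (by linarith), ← EReal.coe_sub, ← ecoe_min, ← ecoe_max,
          EReal.coe_le_coe_iff]
        apply key
        gcongr
      · have h5 : equot (q * (1 + e)) (1 - e) = ⊤ := by simp [equot, h1]
        rw [h5, EReal.top_sub_coe, min_eq_right le_top, ← ecoe_max, EReal.coe_le_coe_iff]
        exact (key _ le_rfl).trans (max_le_max (min_le_right _ _) le_rfl)
    · have h1 : e = 1 := by linarith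
      have h5 : equot (q * (1 + e)) (1 - e) = ⊤ := by simp [equot, h1]
      rw [delta_top _ _ _ _ _ _ (by linarith) (by linarith) (by linarith) (by linarith),
        h5, EReal.top_sub_coe, min_eq_right le_top, ← ecoe_max, EReal.coe_le_coe_iff, ha]
      have hqe : q * (1 + e) / (1 + 1) = q := by rw [h1]; field_simp
      rw [hqe, h1]
      have r1 : q' ≤ q' * (1 + e') / (1 + e' * cos ω') := by
        rw [le_div_iff₀ (by linarith)]; nlinarith
      have r3 : q' * (1 + e') / (1 + e' * cos ω') ≤ Q' := by rw [hQ']; gcongr <;> linarith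
      generalize q' * (1 + e') / (1 + e' * cos ω') = R at r1 r3 ⊢
      by_contra hc
      push Not at hc
      obtain ⟨c1, c2⟩ := max_lt_iff.1 hc
      have P2 := neg_abs_le (q' * (1 + e') - q * (1 + 1))
      rcases abs_cases (R - q) with ⟨w, _⟩ | ⟨w, _⟩ <;>
        rw [w] at c1 c2
      · linarith
      · have : q' * e' < q' := by nlinarith
        clear hqq hqq' hqe hqle
        linarith
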